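/- arXiv:1704.02946 — 5 statements merged into one kernel-verified Lean document; each statement's English description precedes it below -/
import Mathlib

section
/- For every q ∈ ℍ and every I ∈ 𝕊, the function m ↦ (m!)⁻¹ • ((conj q)ᵐ * I * qᵐ) is summable in ℍ, and the quaternion 𝔠_I(q) := exp(−‖q‖²) • ∑'ₘ (m!)⁻¹ • ((conj q)ᵐ * I * qᵐ) satisfies ‖𝔠_I(q)‖ ≤ 1. -/
open scoped Quaternion

/-- For every `q ∈ ℍ` and every `I ∈ 𝕊`, the series `∑ₘ (conj q)ᵐ I qᵐ / m!`
is summable, and `𝔠_I(q) := exp (−‖q‖²) • ∑'ₘ (m!)⁻¹ • ((conj q)ᵐ * I * qᵐ)`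
has norm at most `1`. -/
theorem quaternion_cI_summable_and_norm_le_one
    (q I : ℍ[ℝ]) (hIre : I.re = 0) (hInorm : ‖I‖ = 1) :
    Summable (fun m : ℕ => ((m.factorial : ℝ)⁻¹) • ((star q) ^ m * I * q ^ m)) ∧
    ‖Real.exp (-‖q‖ ^ 2) •
        ∑' m : ℕ, ((m.factorial : ℝ)⁻¹) • ((star q) ^ m * I * q ^ m)‖ ≤ 1 := by
  have h_norm (m : ℕ) : ‖((m.factorial : ℝ)⁻¹) • ((star q) ^ m * I * q ^ m)‖ =
      (‖q‖ ^ 2) ^ m / m.factorial := by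
    rw [norm_smul, norm_mul, norm_mul, norm_pow, norm_pow, Quaternion.norm_star, hInorm,
      norm_inv, RCLike.norm_natCast]
    ring
  have h_exp : HasSum (fun m : ℕ => (‖q‖ ^ 2) ^ m / (m.factorial : ℝ))
      (Real.exp (‖q‖ ^ 2)) := by
    rw [Real.exp_eq_exp_ℝ]
    exact NormedSpace.expSeries_div_hasSum_exp (‖q‖ ^ 2)
  refine ⟨.of_norm_bounded h_exp.summable fun m => (h_norm m).le, ?_⟩
  rw [norm_smul, Real.norm_eq_abs, Real.abs_exp]
  calc
    _ ≤ Real.exp (-‖q‖ ^ 2) * Real.exp (‖q‖ ^ 2) := by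
      gcongr
      exact tsum_of_norm_bounded h_exp fun m => (h_norm m).le
    _ = 1 := by rw [← Real.exp_add, neg_add_cancel, Real.exp_zero]
end

section
/- For every q ∈ ℍ and every I ∈ 𝕊, the quaternion 𝔠_I(q) := exp(−‖q‖²) • ∑'ₘ (m!)⁻¹ • ((conj q)ᵐ * I * qᵐ) is purely imaginary: conj(𝔠_I(q)) = −𝔠_I(q), and consequently 𝔠_I(q)² = −(‖𝔠_I(q)‖² : ℍ). -/
open scoped Quaternion

/-- The square of a purely imaginary quaternion is minus its squared norm. -/
theorem sq_eq_neg_norm_sq_of_star_eq_neg {a : ℍ[ℝ]} (ha : star a = -a) :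
    a ^ 2 = -((‖a‖ ^ 2 : ℝ) : ℍ[ℝ]) := by
  rw [Quaternion.sq_eq_neg_normSq.mpr (Quaternion.star_eq_neg.mp ha),
    Quaternion.normSq_eq_norm_mul_self, sq]

/-- Weighted sums of the conjugates `(star q) ^ m * I * q ^ m` of a purely imaginary quaternion
are purely imaginary. -/
theorem star_exp_smul_tsum (q : ℍ[ℝ]) {I : ℍ[ℝ]} (hI : star I = -I) :
    star (Real.exp (-‖q‖ ^ 2) •
        ∑' m : ℕ, ((m.factorial : ℝ)⁻¹) • ((star q) ^ m * I * q ^ m)) =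
      -(Real.exp (-‖q‖ ^ 2) •
        ∑' m : ℕ, ((m.factorial : ℝ)⁻¹) • ((star q) ^ m * I * q ^ m)) := by
  rw [Quaternion.star_smul, tsum_star, ← smul_neg, ← tsum_neg]
  congr! 3 with m
  rw [Quaternion.star_smul, star_mul, star_mul, star_pow, star_pow, star_star, hI, neg_mul,
    mul_neg, smul_neg, mul_assoc]

/-- For every `q ∈ ℍ` and every `I ∈ 𝕊`, the quaternion
`𝔠_I(q) := exp (−‖q‖²) • ∑'ₘ (m!)⁻¹ • ((conj q)ᵐ * I * qᵐ)` is purely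
imaginary: `conj (𝔠_I(q)) = −𝔠_I(q)`, and consequently
`𝔠_I(q)² = −(‖𝔠_I(q)‖² : ℍ)`. -/
theorem quaternion_cI_purely_imaginary
    (q I : ℍ[ℝ]) (hIre : I.re = 0) (hInorm : ‖I‖ = 1) :
    star (Real.exp (-‖q‖ ^ 2) •
        ∑' m : ℕ, ((m.factorial : ℝ)⁻¹) • ((star q) ^ m * I * q ^ m)) =
      -(Real.exp (-‖q‖ ^ 2) •
        ∑' m : ℕ, ((m.factorial : ℝ)⁻¹) • ((star q) ^ m * I * q ^ m)) ∧
    (Real.exp (-‖q‖ ^ 2) •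
        ∑' m : ℕ, ((m.factorial : ℝ)⁻¹) • ((star q) ^ m * I * q ^ m)) ^ 2 =
      -((‖Real.exp (-‖q‖ ^ 2) •
          ∑' m : ℕ, ((m.factorial : ℝ)⁻¹) • ((star q) ^ m * I * q ^ m)‖ ^ 2 : ℝ) :
        ℍ[ℝ]) := by
  have key := star_exp_smul_tsum q (Quaternion.star_eq_neg.mpr hIre)
  exact ⟨key, sq_eq_neg_norm_sq_of_star_eq_neg key⟩
end

section
/- For every q ∈ ℍ and every I ∈ 𝕊, there exist a real number r ∈ [0, 1] and an imaginary unit quaternion 𝓘 ∈ 𝕊 such that 𝔠_I(q) = r • 𝓘, where 𝔠_I(q) := exp(−‖q‖²) • ∑'ₘ (m!)⁻¹ • ((conj q)ᵐ * I * qᵐ). -/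
open scoped Quaternion

namespace Quaternion

theorem star_conj_pow_smul {I : ℍ[ℝ]} (hI : I.re = 0) (q : ℍ[ℝ]) (m : ℕ) (c : ℝ) :
    star (c • (star q ^ m * I * q ^ m)) = -(c • (star q ^ m * I * q ^ m)) := by
  have hI' : star I = -I := Quaternion.star_eq_neg.2 hI
  simp [star_pow, hI', mul_assoc]

theorem norm_conj_pow_smul {I : ℍ[ℝ]} (hI : ‖I‖ = 1) (q : ℍ[ℝ]) (m : ℕ) :
    ‖((m.factorial : ℝ)⁻¹) • (star q ^ m * I * q ^ m)‖ = (‖q‖ ^ 2) ^ m / m.factorial := by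
  rw [norm_smul, norm_mul, norm_mul, norm_pow, norm_pow, Quaternion.norm_star, hI, norm_inv,
    Real.norm_natCast]
  ring

theorem exists_eq_smul_unit {I c : ℍ[ℝ]} (hI : I.re = 0) (hI' : ‖I‖ = 1)
    (hre : c.re = 0) (hnorm : ‖c‖ ≤ 1) :
    ∃ (r : ℝ) (J : ℍ[ℝ]), r ∈ Set.Icc (0 : ℝ) 1 ∧ J.re = 0 ∧ ‖J‖ = 1 ∧ c = r • J := by
  by_cases hc : c = 0
  · exact ⟨0, I, by simp, hI, hI', by simp [hc]⟩
  · have hc' : ‖c‖ ≠ 0 := norm_ne_zero_iff.2 hc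
    refine ⟨‖c‖, ‖c‖⁻¹ • c, ⟨norm_nonneg c, hnorm⟩, by simp [hre], ?_, ?_⟩
    · rw [norm_smul, norm_inv, norm_norm, inv_mul_cancel₀ hc']
    · rw [smul_smul, mul_inv_cancel₀ hc', one_smul]

end Quaternion

/-- For every `q ∈ ℍ` and every `I ∈ 𝕊`, there exist `r ∈ [0, 1]` and an
imaginary unit quaternion `𝓘 ∈ 𝕊` such that `𝔠_I(q) = r • 𝓘`, where
`𝔠_I(q) := exp (−‖q‖²) • ∑'ₘ (m!)⁻¹ • ((conj q)ᵐ * I * qᵐ)`. -/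
theorem quaternion_cI_eq_smul_unit
    (q I : ℍ[ℝ]) (hIre : I.re = 0) (hInorm : ‖I‖ = 1) :
    ∃ (r : ℝ) (𝓘 : ℍ[ℝ]), r ∈ Set.Icc (0 : ℝ) 1 ∧ 𝓘.re = 0 ∧ ‖𝓘‖ = 1 ∧
      Real.exp (-‖q‖ ^ 2) •
          ∑' m : ℕ, ((m.factorial : ℝ)⁻¹) • ((star q) ^ m * I * q ^ m) =
        r • 𝓘 := by
  apply Quaternion.exists_eq_smul_unit hIre hInorm
  · rw [← Quaternion.star_eq_neg, Quaternion.star_smul, ← smul_neg, tsum_star, ← tsum_neg]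
    simp_rw [Quaternion.star_conj_pow_smul hIre]
  · have hsum : HasSum (fun m : ℕ => (‖q‖ ^ 2) ^ m / m.factorial) (Real.exp (‖q‖ ^ 2)) := by
      rw [Real.exp_eq_exp_ℝ]
      exact NormedSpace.expSeries_div_hasSum_exp (‖q‖ ^ 2)
    have hle := tsum_of_norm_bounded hsum fun m =>
      (Quaternion.norm_conj_pow_smul hInorm q m).le
    calc _ ≤ Real.exp (-‖q‖ ^ 2) * Real.exp (‖q‖ ^ 2) := by
          rw [norm_smul, Real.norm_of_nonneg (Real.exp_pos _).le]
          gcongr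
      _ = 1 := by rw [← Real.exp_add, neg_add_cancel, Real.exp_zero]
end

section
/- The variance of the momentum operator P_I in the coherent state |γ_q⟩ is a nonnegative real number: for every q ∈ ℍ and I ∈ 𝕊, writing 𝔠 := 𝔠_I(q) = exp(−‖q‖²) • ∑'ₘ (m!)⁻¹ • ((conj q)ᵐ * I * qᵐ), the quaternion V := −(1/2) • (q² − 1 − 2‖q‖² + (conj q)²) − (1/2) • ((𝔠 * q)² + 2‖𝔠 * q‖² + (conj(𝔠 * q))²) has zero imaginary part and nonnegative real part. -/
open scoped Quaternion

namespace Quaternion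

theorem re_mul_comm (a b : ℍ[ℝ]) : (a * b).re = (b * a).re := by
  simp only [re_mul]; ring

theorem re_star_pow_mul_mul_pow_mul (q a : ℍ[ℝ]) (m : ℕ) :
    (star q ^ m * a * q ^ m * q).re = (‖q‖ ^ 2) ^ m * (a * q).re := by
  have h : q ^ m * q * star q ^ m = (((‖q‖ ^ 2) ^ m : ℝ) : ℍ[ℝ]) * q := by
    rw [← pow_succ, pow_succ', mul_assoc, ← (show Commute q (star q) from (self_mul_star q).trans
      (star_mul_self q).symm).mul_pow, self_mul_star, normSq_eq_norm_mul_self, ← sq, ← coe_pow,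
      ← coe_commutes]
  rw [mul_assoc, mul_assoc, re_mul_comm, mul_assoc, h, ← mul_assoc, ← coe_commutes, mul_assoc,
    coe_mul_eq_smul, re_smul, smul_eq_mul]

theorem summable_star_pow_mul_mul_pow (q a : ℍ[ℝ]) :
    Summable fun m : ℕ => ((m.factorial : ℝ)⁻¹) • (star q ^ m * a * q ^ m) := by
  refine .of_norm (((Real.summable_pow_div_factorial (‖q‖ ^ 2)).mul_right ‖a‖).congr fun m => ?_)
  rw [norm_smul, norm_mul, norm_mul, norm_pow, norm_pow, norm_star, norm_inv, Real.norm_natCast]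
  ring

/-- Conjugating by the coherent state does not change the real part of the product with `q`. -/
theorem re_exp_smul_tsum_mul (q a : ℍ[ℝ]) :
    ((Real.exp (-‖q‖ ^ 2) •
      ∑' m : ℕ, ((m.factorial : ℝ)⁻¹) • (star q ^ m * a * q ^ m)) * q).re = (a * q).re := by
  let f : ℍ[ℝ] →+ ℝ :=
    { toFun x := (x * q).re
      map_zero' := by simp
      map_add' x y := by rw [add_mul, re_add] }
  have hf : Continuous f := continuous_re.comp (continuous_id.mul continuous_const)
  have h₁ := (summable_star_pow_mul_mul_pow q a).hasSum.map f hf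
  have h₂ : HasSum (fun m : ℕ => (‖q‖ ^ 2) ^ m / m.factorial * (a * q).re)
      (Real.exp (‖q‖ ^ 2) * (a * q).re) := by
    refine HasSum.mul_right _ ?_
    rw [Real.exp_eq_exp_ℝ]
    exact NormedSpace.expSeries_div_hasSum_exp (‖q‖ ^ 2)
  have h₃ : ⇑f ∘ (fun m : ℕ => ((m.factorial : ℝ)⁻¹) • (star q ^ m * a * q ^ m)) =
      fun m : ℕ => (‖q‖ ^ 2) ^ m / m.factorial * (a * q).re := by
    ext m
    change (((m.factorial : ℝ)⁻¹ • (star q ^ m * a * q ^ m)) * q).re = _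
    rw [smul_mul_assoc, re_smul, re_star_pow_mul_mul_pow_mul, smul_eq_mul]
    ring
  rw [h₃] at h₁
  have h₄ := h₁.unique h₂
  change ((∑' m : ℕ, ((m.factorial : ℝ)⁻¹) • (star q ^ m * a * q ^ m)) * q).re = _ at h₄
  rw [smul_mul_assoc, re_smul, h₄, smul_eq_mul, ← mul_assoc, ← Real.exp_add, neg_add_cancel,
    Real.exp_zero, one_mul]

theorem sq_add_norm_add_star_sq (p : ℍ[ℝ]) :
    p ^ 2 + ((2 * ‖p‖ ^ 2 : ℝ) : ℍ[ℝ]) + star p ^ 2 = ((4 * p.re ^ 2 : ℝ) : ℍ[ℝ]) := by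
  rw [sq ‖p‖, ← normSq_eq_norm_mul_self, normSq_def']
  ext <;> simp [sq] <;> ring

theorem sq_sub_norm_add_star_sq (p : ℍ[ℝ]) :
    p ^ 2 - ((2 * ‖p‖ ^ 2 : ℝ) : ℍ[ℝ]) + star p ^ 2 =
      ((-4 * (p.imI ^ 2 + p.imJ ^ 2 + p.imK ^ 2) : ℝ) : ℍ[ℝ]) := by
  rw [sq ‖p‖, ← normSq_eq_norm_mul_self, normSq_def']
  ext <;> simp [sq] <;> ring

theorem re_mul_sq_le_of_re_eq_zero {a : ℍ[ℝ]} (ha : a.re = 0) (ha' : ‖a‖ = 1) (q : ℍ[ℝ]) :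
    (a * q).re ^ 2 ≤ q.imI ^ 2 + q.imJ ^ 2 + q.imK ^ 2 := by
  have h : a.imI ^ 2 + a.imJ ^ 2 + a.imK ^ 2 = 1 := by
    have := normSq_eq_norm_mul_self a
    rw [normSq_def', ha, ha'] at this
    linarith
  rw [re_mul, ha]
  linear_combination (q.imI ^ 2 + q.imJ ^ 2 + q.imK ^ 2) * h +
    sq_nonneg (a.imI * q.imJ - a.imJ * q.imI) + sq_nonneg (a.imI * q.imK - a.imK * q.imI) +
    sq_nonneg (a.imJ * q.imK - a.imK * q.imJ)

end Quaternion

/-- The variance of the momentum operator `P_I` in the coherent state `|γ_q⟩`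
is a nonnegative real number: for every `q ∈ ℍ` and `I ∈ 𝕊`, writing
`𝔠 := 𝔠_I(q)`, the quaternion
`V := −(1/2) • (q² − 1 − 2‖q‖² + (conj q)²)
      − (1/2) • ((𝔠 q)² + 2‖𝔠 q‖² + (conj (𝔠 q))²)`
has zero imaginary part and nonnegative real part. -/
theorem quaternion_momentum_variance_nonneg_real
    (q I : ℍ[ℝ]) (hIre : I.re = 0) (hInorm : ‖I‖ = 1)
    (𝔠 : ℍ[ℝ])
    (h𝔠 : 𝔠 = Real.exp (-‖q‖ ^ 2) •
        ∑' m : ℕ, ((m.factorial : ℝ)⁻¹) • ((star q) ^ m * I * q ^ m))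
    (V : ℍ[ℝ])
    (hV : V = -(1 / 2 : ℝ) •
          (q ^ 2 - 1 - ((2 * ‖q‖ ^ 2 : ℝ) : ℍ[ℝ]) + (star q) ^ 2)
        - (1 / 2 : ℝ) •
          ((𝔠 * q) ^ 2 + ((2 * ‖𝔠 * q‖ ^ 2 : ℝ) : ℍ[ℝ]) + (star (𝔠 * q)) ^ 2)) :
    V.im = 0 ∧ 0 ≤ V.re := by
  have hre : (𝔠 * q).re = (I * q).re := by rw [h𝔠, Quaternion.re_exp_smul_tsum_mul]
  have hle := Quaternion.re_mul_sq_le_of_re_eq_zero hIre hInorm q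
  have key : V = ((1 / 2 + 2 * (q.imI ^ 2 + q.imJ ^ 2 + q.imK ^ 2) - 2 * (I * q).re ^ 2 : ℝ) :
      ℍ[ℝ]) := by
    rw [hV, Quaternion.sq_add_norm_add_star_sq, hre, sub_right_comm (q ^ 2), sub_add_eq_add_sub,
      Quaternion.sq_sub_norm_add_star_sq]
    rw [← Quaternion.coe_one, ← Quaternion.coe_sub, ← Quaternion.coe_smul, ← Quaternion.coe_smul,
      ← Quaternion.coe_sub, Quaternion.coe_inj, smul_eq_mul, smul_eq_mul]
    ring
  rw [key, Quaternion.im_coe, Quaternion.re_coe]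
  exact ⟨rfl, by linarith⟩
end

section
/- Approximate Heisenberg uncertainty bound: for every q ∈ ℍ and I ∈ 𝕊, writing 𝔠 := 𝔠_I(q) = exp(−‖q‖²) • ∑'ₘ (m!)⁻¹ • ((conj q)ᵐ * I * qᵐ) and V := −(1/2) • (q² − 1 − 2‖q‖² + (conj q)²) − (1/2) • ((𝔠 * q)² + 2‖𝔠 * q‖² + (conj(𝔠 * q))²) (a nonnegative real quaternion), the product (1/2) · re(V) of the position variance 1/2 and the momentum variance re(V) satisfies 1/4 − ‖q‖² ≤ (1/2) · re(V) ≤ 1/4 + ‖q‖²; in particular |(1/2) · re(V) − 1/4| ≤ ‖q‖². -/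
open scoped Quaternion

/-- The exponentially weighted sum `exp (-‖q‖²) • ∑ (m!)⁻¹ • ((conj q)ᵐ * I * qᵐ)` has norm at most
`1` when `I` does. -/
theorem norm_exp_smul_tsum_star_pow_mul_mul_pow_le_one (q I : ℍ[ℝ]) (hI : ‖I‖ ≤ 1) :
    ‖Real.exp (-‖q‖ ^ 2) •
      ∑' m : ℕ, ((m.factorial : ℝ)⁻¹) • ((star q) ^ m * I * q ^ m)‖ ≤ 1 := by
  have hexp : HasSum (fun m : ℕ => (m.factorial : ℝ)⁻¹ * (‖q‖ ^ 2) ^ m)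
      (Real.exp (‖q‖ ^ 2)) := by
    have h := NormedSpace.exp_series_hasSum_exp' (𝕂 := ℝ) (‖q‖ ^ 2)
    rw [← Real.exp_eq_exp_ℝ] at h
    simpa only [smul_eq_mul] using h
  have hle : ‖∑' m : ℕ, ((m.factorial : ℝ)⁻¹) • ((star q) ^ m * I * q ^ m)‖
      ≤ Real.exp (‖q‖ ^ 2) := by
    refine tsum_of_norm_bounded hexp fun m => ?_
    rw [norm_smul, norm_mul, norm_mul, norm_pow, norm_pow, norm_star, norm_inv,
      Real.norm_natCast]
    gcongr
    calc ‖q‖ ^ m * ‖I‖ * ‖q‖ ^ m ≤ ‖q‖ ^ m * 1 * ‖q‖ ^ m := by gcongr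
      _ = (‖q‖ ^ 2) ^ m := by ring
  rw [norm_smul, Real.norm_of_nonneg (Real.exp_pos _).le]
  calc Real.exp (-‖q‖ ^ 2) * _ ≤ Real.exp (-‖q‖ ^ 2) * Real.exp (‖q‖ ^ 2) := by gcongr
    _ = 1 := by rw [← Real.exp_add, neg_add_cancel, Real.exp_zero]

theorem Quaternion.norm_sq_eq_sum_sq (p : ℍ[ℝ]) :
    ‖p‖ ^ 2 = p.re ^ 2 + p.imI ^ 2 + p.imJ ^ 2 + p.imK ^ 2 := by
  rw [sq ‖p‖, ← Quaternion.normSq_eq_norm_mul_self, Quaternion.normSq_def']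

/-- Approximate Heisenberg uncertainty bound: for every `q ∈ ℍ` and `I ∈ 𝕊`,
writing `𝔠 := 𝔠_I(q)` and
`V := −(1/2) • (q² − 1 − 2‖q‖² + (conj q)²)
      − (1/2) • ((𝔠 q)² + 2‖𝔠 q‖² + (conj (𝔠 q))²)`,
the product `(1/2) * re V` of the position variance `1/2` and the momentum
variance `re V` satisfies `1/4 − ‖q‖² ≤ (1/2) * re V ≤ 1/4 + ‖q‖²`; in
particular `|(1/2) * re V − 1/4| ≤ ‖q‖²`. -/
theorem quaternion_heisenberg_uncertainty_bound
    (q I : ℍ[ℝ]) (hIre : I.re = 0) (hInorm : ‖I‖ = 1)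
    (𝔠 : ℍ[ℝ])
    (h𝔠 : 𝔠 = Real.exp (-‖q‖ ^ 2) •
        ∑' m : ℕ, ((m.factorial : ℝ)⁻¹) • ((star q) ^ m * I * q ^ m))
    (V : ℍ[ℝ])
    (hV : V = -(1 / 2 : ℝ) •
          (q ^ 2 - 1 - ((2 * ‖q‖ ^ 2 : ℝ) : ℍ[ℝ]) + (star q) ^ 2)
        - (1 / 2 : ℝ) •
          ((𝔠 * q) ^ 2 + ((2 * ‖𝔠 * q‖ ^ 2 : ℝ) : ℍ[ℝ]) + (star (𝔠 * q)) ^ 2)) :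
    (1 / 4 - ‖q‖ ^ 2 ≤ (1 / 2) * V.re ∧ (1 / 2) * V.re ≤ 1 / 4 + ‖q‖ ^ 2) ∧
      |(1 / 2) * V.re - 1 / 4| ≤ ‖q‖ ^ 2 := by
  have hc : ‖𝔠‖ ≤ 1 :=
    h𝔠 ▸ norm_exp_smul_tsum_star_pow_mul_mul_pow_le_one q I hInorm.le
  have hcq : ‖𝔠 * q‖ ^ 2 ≤ ‖q‖ ^ 2 := by
    rw [norm_mul]
    gcongr
    exact mul_le_of_le_one_left (norm_nonneg q) hc
  have hV' : (1 / 2) * V.re = 1 / 4 + (‖q‖ ^ 2 - q.re ^ 2) - (𝔠 * q).re ^ 2 := by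
    rw [hV]
    generalize 𝔠 * q = p
    simp only [Quaternion.norm_sq_eq_sum_sq, sq q, sq p, sq (star q), sq (star p),
      Quaternion.re_sub, Quaternion.re_add, Quaternion.re_smul, Quaternion.re_mul,
      Quaternion.re_star, Quaternion.imI_star, Quaternion.imJ_star, Quaternion.imK_star,
      Quaternion.re_one, Quaternion.re_coe, smul_eq_mul]
    ring
  have hq := Quaternion.norm_sq_eq_sum_sq q
  have hp := Quaternion.norm_sq_eq_sum_sq (𝔠 * q)
  have hlower : 1 / 4 - ‖q‖ ^ 2 ≤ (1 / 2) * V.re := by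
    nlinarith [sq_nonneg q.imI, sq_nonneg q.imJ, sq_nonneg q.imK, sq_nonneg (𝔠 * q).imI,
      sq_nonneg (𝔠 * q).imJ, sq_nonneg (𝔠 * q).imK]
  have hupper : (1 / 2) * V.re ≤ 1 / 4 + ‖q‖ ^ 2 := by
    nlinarith [sq_nonneg q.re, sq_nonneg (𝔠 * q).re]
  exact ⟨⟨hlower, hupper⟩, abs_le.mpr ⟨by linarith, by linarith⟩⟩
end
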